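/- arXiv:1612.05075 — 6 statements merged into one kernel-verified Lean document; each statement's English description precedes it below -/
import Mathlib

section
/- Let f and g be continuous, strictly positive probability density functions on [0,1] (so ∫₀¹ f = ∫₀¹ g = 1), with cumulative distribution functions F(x) = ∫₀ˣ f(t) dt and G(y) = ∫₀ʸ g(t) dt, and let T = G⁻¹ ∘ F. Then T is optimal for the quadratic Monge transport problem: for every Borel measurable map S : [0,1] → [0,1] such that the pushforward of the measure f(x)dx under S equals the measure g(y)dy, one has ∫₀¹ |x − T(x)|² f(x) dx ≤ ∫₀¹ |x − S(x)|² f(x) dx. -/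
open MeasureTheory Set

/-- The measure on `[0,1]` with density `f` with respect to Lebesgue measure. -/
noncomputable def densMeasure (f : ℝ → ℝ) : Measure ℝ :=
  (volume.restrict (Icc (0:ℝ) 1)).withDensity fun x => ENNReal.ofReal (f x)

lemma hasDerivAt_cdf {f : ℝ → ℝ} (hfc : ContinuousOn f (Icc 0 1)) {x : ℝ} (hx : x ∈ Ioo (0:ℝ) 1) :
    HasDerivAt (fun x => ∫ t in (0:ℝ)..x, f t) (f x) x := by
  have hsub : Icc 0 x ⊆ Icc (0:ℝ) 1 := Icc_subset_Icc_right hx.2.le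
  refine intervalIntegral.integral_hasDerivAt_right
    ((hfc.mono hsub).intervalIntegrable_of_Icc hx.1.le) ?_
    (hfc.continuousAt (Icc_mem_nhds hx.1 hx.2))
  exact (hfc.mono Ioo_subset_Icc_self).stronglyMeasurableAtFilter isOpen_Ioo x hx

lemma continuousOn_cdf {f : ℝ → ℝ} (hfc : ContinuousOn f (Icc 0 1)) :
    ContinuousOn (fun x => ∫ t in (0:ℝ)..x, f t) (Icc 0 1) := by
  have h := intervalIntegral.continuousOn_primitive_interval (μ := volume) (f := f) (a := 0) (b := 1)
  rw [uIcc_of_le zero_le_one] at h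
  exact h (hfc.integrableOn_Icc)

lemma strictMonoOn_cdf {f : ℝ → ℝ} (hfc : ContinuousOn f (Icc 0 1))
    (hfpos : ∀ x ∈ Icc (0:ℝ) 1, 0 < f x) :
    StrictMonoOn (fun x => ∫ t in (0:ℝ)..x, f t) (Icc 0 1) := by
  refine strictMonoOn_of_deriv_pos (convex_Icc 0 1) (continuousOn_cdf hfc) fun x hx => ?_
  rw [interior_Icc] at hx
  rw [(hasDerivAt_cdf hfc hx).deriv]
  exact hfpos x (Ioo_subset_Icc_self hx)

lemma mapsTo_cdf {f : ℝ → ℝ} (hfc : ContinuousOn f (Icc 0 1))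
    (hfpos : ∀ x ∈ Icc (0:ℝ) 1, 0 < f x) (hf1 : (∫ x in (0:ℝ)..1, f x) = 1) :
    MapsTo (fun x => ∫ t in (0:ℝ)..x, f t) (Icc 0 1) (Icc 0 1) := by
  intro x hx
  have hm := (strictMonoOn_cdf hfc hfpos).monotoneOn
  have h0 := hm (left_mem_Icc.2 zero_le_one) hx hx.1
  have h1 := hm hx (right_mem_Icc.2 zero_le_one) hx.2
  simp only [intervalIntegral.integral_same, hf1] at h0 h1
  exact ⟨h0, h1⟩

/-- The cumulative distribution function of `f` pushes `f(x) dx` forward to Lebesgue measure. -/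
lemma integral_comp_cdf_mul {f h : ℝ → ℝ} (hfc : ContinuousOn f (Icc 0 1))
    (hfpos : ∀ x ∈ Icc (0:ℝ) 1, 0 < f x) (hf1 : (∫ x in (0:ℝ)..1, f x) = 1)
    (hh : ContinuousOn h (Icc 0 1)) :
    (∫ x in (0:ℝ)..1, h (∫ t in (0:ℝ)..x, f t) * f x) = ∫ s in (0:ℝ)..1, h s := by
  have hmaps := mapsTo_cdf hfc hfpos hf1
  have hcont := continuousOn_cdf hfc
  have key := intervalIntegral.integral_comp_mul_deriv''' (a := 0) (b := 1) (g := h) (f' := f)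
    (f := fun x => ∫ t in (0:ℝ)..x, f t)
  simp only [uIcc_of_le (zero_le_one' ℝ), min_eq_left (zero_le_one' ℝ),
    max_eq_right (zero_le_one' ℝ), intervalIntegral.integral_same, hf1] at key
  exact key hcont (fun x hx => (hasDerivAt_cdf hfc hx).hasDerivWithinAt)
    (hh.mono ((hmaps.mono_left Ioo_subset_Icc_self).image_subset))
    (hh.integrableOn_Icc.mono_set hmaps.image_subset)
    ((hh.comp hcont hmaps).mul hfc).integrableOn_Icc

lemma integral_densMeasure {f : ℝ → ℝ} (hfc : ContinuousOn f (Icc 0 1))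
    (hfpos : ∀ x ∈ Icc (0:ℝ) 1, 0 < f x) (h : ℝ → ℝ) :
    ∫ x, h x ∂densMeasure f = ∫ x in (0:ℝ)..1, h x * f x := by
  rw [densMeasure, integral_withDensity_eq_integral_toReal_smul₀
    (hfc.aemeasurable measurableSet_Icc).ennreal_ofReal (by simp),
    intervalIntegral.integral_of_le zero_le_one, ← integral_Icc_eq_integral_Ioc]
  refine setIntegral_congr_fun measurableSet_Icc fun x hx => ?_
  simp only [ENNReal.toReal_ofReal (hfpos x hx).le, smul_eq_mul, mul_comm]

/-- A right inverse on `[0,1]` of a strictly increasing self-map is monotone and continuous. -/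
lemma StrictMonoOn.monotoneOn_and_continuousOn_of_rightInverse {G Ginv : ℝ → ℝ}
    (hG : StrictMonoOn G (Icc 0 1)) (hmaps : MapsTo G (Icc 0 1) (Icc 0 1))
    (hGinv : ∀ y ∈ Icc (0:ℝ) 1, Ginv y ∈ Icc (0:ℝ) 1 ∧ G (Ginv y) = y) :
    MonotoneOn Ginv (Icc 0 1) ∧ ContinuousOn Ginv (Icc 0 1) := by
  have hmono : MonotoneOn Ginv (Icc 0 1) := fun a ha b hb hab => by
    rwa [← hG.le_iff_le (hGinv a ha).1 (hGinv b hb).1, (hGinv a ha).2, (hGinv b hb).2]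
  refine ⟨hmono, ?_⟩
  have hm : MapsTo Ginv (Icc 0 1) (Icc 0 1) := fun y hy => (hGinv y hy).1
  have hc : Continuous (hm.restrict Ginv (Icc 0 1) (Icc 0 1)) := by
    refine Monotone.continuous_of_surjective (fun a b hab => hmono a.2 b.2 hab) fun x => ?_
    refine ⟨⟨G x, hmaps x.2⟩, Subtype.ext ?_⟩
    exact hG.injOn (hGinv _ (hmaps x.2)).1 x.2 (hGinv _ (hmaps x.2)).2
  exact continuousOn_iff_continuous_domRestrict.2 (continuous_subtype_val.comp hc)

/-- A continuous increasing map admits continuous Kantorovich potentials for the quadratic cost. -/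
lemma exists_quadratic_potentials {T : ℝ → ℝ} (hTm : MonotoneOn T (Icc 0 1))
    (hTc : ContinuousOn T (Icc 0 1)) :
    ∃ α β : ℝ → ℝ, Continuous α ∧ Continuous β ∧
      (∀ x ∈ Icc (0:ℝ) 1, ∀ y, α x + β y ≤ |x - y| ^ 2) ∧
      ∀ x ∈ Icc (0:ℝ) 1, α x + β (T x) = |x - T x| ^ 2 := by
  let E : ℝ → ℝ := IccExtend (zero_le_one' ℝ) ((Icc 0 1).domRestrict T)
  have hE : ∀ x ∈ Icc (0:ℝ) 1, E x = T x := fun x hx => IccExtend_of_mem _ _ hx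
  have hEc : Continuous E := (continuousOn_iff_continuous_domRestrict.1 hTc).Icc_extend'
  have hEm : Monotone E := Monotone.IccExtend _ fun a b hab => hTm a.2 b.2 hab
  let φ : ℝ → ℝ := fun x => ∫ t in (0:ℝ)..x, E t
  have hφc : Continuous φ :=
    intervalIntegral.continuous_primitive (fun a b => hEc.intervalIntegrable a b) 0
  have hφ : ∀ u x, (x - u) * E u ≤ φ x - φ u := by
    intro u x
    have hsub : φ x - φ u = ∫ t in u..x, E t :=
      intervalIntegral.integral_interval_sub_left (hEc.intervalIntegrable _ _)
        (hEc.intervalIntegrable _ _)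
    rw [hsub]
    rcases le_total u x with h | h
    · have := intervalIntegral.integral_mono_on h (intervalIntegrable_const (μ := volume))
        (hEc.intervalIntegrable u x) fun t ht => hEm ht.1
      simpa using this
    · have := intervalIntegral.integral_mono_on h (hEc.intervalIntegrable x u)
        (intervalIntegrable_const (μ := volume)) fun t ht => hEm ht.2
      rw [intervalIntegral.integral_const, smul_eq_mul] at this
      rw [intervalIntegral.integral_symm]
      linarith
  let ψ : ℝ → ℝ := fun y => sSup ((fun x => x * y - φ x) '' Icc 0 1)
  have hψc : Continuous ψ :=
    isCompact_Icc.continuous_sSup (f := fun y x : ℝ => x * y - φ x) (by fun_prop)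
  have hle : ∀ x ∈ Icc (0:ℝ) 1, ∀ y, x * y - φ x ≤ ψ y := fun x hx y =>
    le_csSup (isCompact_Icc.bddAbove_image (by fun_prop)) (mem_image_of_mem _ hx)
  have hge : ∀ x ∈ Icc (0:ℝ) 1, ψ (T x) ≤ x * T x - φ x := fun x hx => by
    refine csSup_le ((nonempty_Icc.2 zero_le_one).image _) ?_
    rintro _ ⟨z, -, rfl⟩
    have := hφ x z
    rw [hE x hx] at this
    dsimp only
    linarith
  refine ⟨fun x => x ^ 2 - 2 * φ x, fun y => y ^ 2 - 2 * ψ y, by fun_prop, by fun_prop,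
    fun x hx y => ?_, fun x hx => ?_⟩
  · rw [sq_abs]
    linarith [hle x hx y]
  · rw [sq_abs]
    linarith [hle x hx (T x), hge x hx]

lemma intervalIntegrable_comp_mul {f S : ℝ → ℝ} {h : ℝ → ℝ → ℝ} (hfc : ContinuousOn f (Icc 0 1))
    (hSm : Measurable S) (hSmaps : MapsTo S (Icc 0 1) (Icc 0 1))
    (hh : Continuous (Function.uncurry h)) :
    IntervalIntegrable (fun x => h x (S x) * f x) volume 0 1 := by
  obtain ⟨C, hC⟩ := (isCompact_Icc.prod isCompact_Icc).exists_bound_of_continuousOn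
    (s := Icc (0:ℝ) 1 ×ˢ Icc (0:ℝ) 1) hh.continuousOn
  rw [intervalIntegrable_iff_integrableOn_Icc_of_le zero_le_one]
  refine hfc.integrableOn_Icc.bdd_mul (c := C)
    (hh.measurable.comp (measurable_id.prodMk hSm)).aestronglyMeasurable ?_
  exact (ae_restrict_mem measurableSet_Icc).mono fun x hx => hC (x, S x) ⟨hx, hSmaps hx⟩

/-- Optimal transportation for a quadratic cost on ℝ: the monotone rearrangement
`T = G⁻¹ ∘ F` is optimal among all Borel transport maps from `f` to `g`. -/
theorem monotone_rearrangement_optimal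
    (f g F G Ginv : ℝ → ℝ)
    (hfc : ContinuousOn f (Icc 0 1)) (hgc : ContinuousOn g (Icc 0 1))
    (hfpos : ∀ x ∈ Icc (0:ℝ) 1, 0 < f x) (hgpos : ∀ x ∈ Icc (0:ℝ) 1, 0 < g x)
    (hf1 : (∫ x in (0:ℝ)..1, f x) = 1) (hg1 : (∫ x in (0:ℝ)..1, g x) = 1)
    (hF : ∀ x, F x = ∫ t in (0:ℝ)..x, f t) (hG : ∀ y, G y = ∫ t in (0:ℝ)..y, g t)
    (hGinv : ∀ y ∈ Icc (0:ℝ) 1, Ginv y ∈ Icc (0:ℝ) 1 ∧ G (Ginv y) = y)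
    (T : ℝ → ℝ) (hT : ∀ x, T x = Ginv (F x))
    (S : ℝ → ℝ) (hSm : Measurable S) (hSmaps : MapsTo S (Icc 0 1) (Icc 0 1))
    (hSpush : Measure.map S (densMeasure f) = densMeasure g) :
    (∫ x in (0:ℝ)..1, |x - T x| ^ 2 * f x) ≤ ∫ x in (0:ℝ)..1, |x - S x| ^ 2 * f x := by
  obtain rfl : F = fun x => ∫ t in (0:ℝ)..x, f t := funext hF
  obtain rfl : G = fun y => ∫ t in (0:ℝ)..y, g t := funext hG
  obtain rfl : T = fun x => Ginv (∫ t in (0:ℝ)..x, f t) := funext hT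
  have hGm := strictMonoOn_cdf hgc hgpos
  have hGmaps := mapsTo_cdf hgc hgpos hg1
  have hFmaps := mapsTo_cdf hfc hfpos hf1
  obtain ⟨hIm, hIc⟩ := hGm.monotoneOn_and_continuousOn_of_rightInverse hGmaps hGinv
  have hTc := hIc.comp (continuousOn_cdf hfc) hFmaps
  obtain ⟨α, β, hα, hβ, hle, heq⟩ := exists_quadratic_potentials
    (hIm.comp (strictMonoOn_cdf hfc hfpos).monotoneOn hFmaps) hTc
  have hβS : (∫ x in (0:ℝ)..1, β (S x) * f x) = ∫ y in (0:ℝ)..1, β y * g y := by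
    rw [← integral_densMeasure hgc hgpos, ← hSpush, ← integral_densMeasure hfc hfpos]
    exact (integral_map hSm.aemeasurable hβ.aestronglyMeasurable).symm
  have hβT : (∫ x in (0:ℝ)..1, β (Ginv (∫ t in (0:ℝ)..x, f t)) * f x)
      = ∫ y in (0:ℝ)..1, β y * g y := by
    have hβI : ContinuousOn (fun s => β (Ginv s)) (Icc 0 1) := hβ.comp_continuousOn hIc
    rw [integral_comp_cdf_mul hfc hfpos hf1 hβI, ← integral_comp_cdf_mul hgc hgpos hg1 hβI]
    refine intervalIntegral.integral_congr fun y hy => ?_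
    rw [uIcc_of_le zero_le_one] at hy
    have hinv : Ginv (∫ t in (0:ℝ)..y, g t) = y :=
      hGm.injOn (hGinv _ (hGmaps hy)).1 hy (hGinv _ (hGmaps hy)).2
    simp only [hinv]
  have hiα : IntervalIntegrable (fun x => α x * f x) volume 0 1 :=
    (hα.continuousOn.mul hfc).intervalIntegrable_of_Icc zero_le_one
  have hiβT : IntervalIntegrable (fun x => β (Ginv (∫ t in (0:ℝ)..x, f t)) * f x) volume 0 1 :=
    ((hβ.comp_continuousOn hTc).mul hfc).intervalIntegrable_of_Icc zero_le_one
  have hiβS : IntervalIntegrable (fun x => β (S x) * f x) volume 0 1 :=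
    intervalIntegrable_comp_mul (h := fun _ y => β y) hfc hSm hSmaps (hβ.comp continuous_snd)
  have hiS : IntervalIntegrable (fun x => |x - S x| ^ 2 * f x) volume 0 1 :=
    intervalIntegrable_comp_mul (h := fun x y => |x - y| ^ 2) hfc hSm hSmaps (by fun_prop)
  calc (∫ x in (0:ℝ)..1, |x - Ginv (∫ t in (0:ℝ)..x, f t)| ^ 2 * f x)
      = ∫ x in (0:ℝ)..1, (α x * f x + β (Ginv (∫ t in (0:ℝ)..x, f t)) * f x) := by
        refine intervalIntegral.integral_congr fun x hx => ?_
        rw [uIcc_of_le zero_le_one] at hx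
        simp only [← add_mul]
        exact congrArg (· * f x) (heq x hx).symm
    _ = ∫ x in (0:ℝ)..1, (α x * f x + β (S x) * f x) := by
        rw [intervalIntegral.integral_add hiα hiβT, intervalIntegral.integral_add hiα hiβS,
          hβT, hβS]
    _ ≤ ∫ x in (0:ℝ)..1, |x - S x| ^ 2 * f x := by
        refine intervalIntegral.integral_mono_on zero_le_one (hiα.add hiβS) hiS fun x hx => ?_
        rw [← add_mul]
        exact mul_le_mul_of_nonneg_right (hle x hx _) (hfpos x hx).le
end

section
/- Let f and g be continuous, strictly positive probability density functions on [0,1], with cumulative distribution functions F and G, and let T = G⁻¹ ∘ F. If S : [0,1] → [0,1] is any nondecreasing Borel map such that the pushforward of the measure f(x)dx under S equals the measure g(y)dy, then S(x) = T(x) for Lebesgue-almost every x ∈ [0,1]; that is, the monotone rearrangement is the unique (up to null sets) monotone transport map from f to g. -/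
open MeasureTheory Set

lemma densMeasure_Iic {f : ℝ → ℝ} (hfc : ContinuousOn f (Icc 0 1))
    (hfpos : ∀ x ∈ Icc (0:ℝ) 1, 0 < f x) {a : ℝ} (ha : a ∈ Icc (0:ℝ) 1) :
    densMeasure f (Iic a) = ENNReal.ofReal (∫ t in (0:ℝ)..a, f t) := by
  have hsub : Icc 0 a ⊆ Icc (0:ℝ) 1 := Icc_subset_Icc_right ha.2
  have hset : Iic a ∩ Icc (0:ℝ) 1 = Icc 0 a := by
    ext t
    simp only [mem_inter_iff, mem_Iic, mem_Icc]
    exact ⟨fun h => ⟨h.2.1, h.1⟩, fun h => ⟨h.2, h.1, h.2.trans ha.2⟩⟩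
  rw [densMeasure, withDensity_apply _ measurableSet_Iic,
    Measure.restrict_restrict measurableSet_Iic, hset,
    intervalIntegral.integral_of_le ha.1, ← integral_Icc_eq_integral_Ioc,
    ofReal_integral_eq_lintegral_ofReal ((hfc.mono hsub).integrableOn_Icc)]
  exact (ae_restrict_mem measurableSet_Icc).mono fun t ht => (hfpos t (hsub ht)).le

lemma densMeasure_absolutelyContinuous (f : ℝ → ℝ) : densMeasure f ≪ volume :=
  (withDensity_absolutelyContinuous _ _).trans Measure.restrict_le_self.absolutelyContinuous

lemma densMeasure_Iio (f : ℝ → ℝ) (a : ℝ) : densMeasure f (Iio a) = densMeasure f (Iic a) :=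
  measure_congr ((densMeasure_absolutelyContinuous f).ae_eq Iio_ae_eq_Iic)

lemma ae_mem_Icc_densMeasure (f : ℝ → ℝ) : ∀ᵐ x ∂densMeasure f, x ∈ Icc (0:ℝ) 1 :=
  (withDensity_absolutelyContinuous _ _).ae_le (ae_restrict_mem measurableSet_Icc)

lemma strictMonoOn_integral {g : ℝ → ℝ} (hgc : ContinuousOn g (Icc 0 1))
    (hgpos : ∀ x ∈ Icc (0:ℝ) 1, 0 < g x) :
    StrictMonoOn (fun y => ∫ t in (0:ℝ)..y, g t) (Icc 0 1) := by
  intro a ha b hb hab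
  have hint : ∀ {u v : ℝ}, u ∈ Icc (0:ℝ) 1 → v ∈ Icc (0:ℝ) 1 →
      IntervalIntegrable g volume u v := fun hu hv =>
    (hgc.mono (uIcc_subset_Icc hu hv)).intervalIntegrable
  have h0 : (0:ℝ) ∈ Icc (0:ℝ) 1 := by simp
  have hpos : 0 < ∫ t in a..b, g t :=
    intervalIntegral.intervalIntegral_pos_of_pos_on (hint ha hb)
      (fun t ht => hgpos t ⟨ha.1.trans ht.1.le, ht.2.le.trans hb.2⟩) hab
  have hadd := intervalIntegral.integral_add_adjacent_intervals (hint h0 ha) (hint ha hb)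
  dsimp only
  linarith

/-- A monotone transport map preserves the mass of initial segments. -/
lemma integral_eq_of_monotoneOn_of_map_eq {f g S : ℝ → ℝ}
    (hfc : ContinuousOn f (Icc 0 1)) (hgc : ContinuousOn g (Icc 0 1))
    (hfpos : ∀ x ∈ Icc (0:ℝ) 1, 0 < f x) (hgpos : ∀ x ∈ Icc (0:ℝ) 1, 0 < g x)
    (hSm : Measurable S) (hSmono : MonotoneOn S (Icc (0:ℝ) 1))
    (hSmaps : MapsTo S (Icc 0 1) (Icc 0 1))
    (hSpush : Measure.map S (densMeasure f) = densMeasure g)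
    {x : ℝ} (hx : x ∈ Icc (0:ℝ) 1) :
    (∫ t in (0:ℝ)..S x, g t) = ∫ t in (0:ℝ)..x, f t := by
  have hle : densMeasure f (Iic x) ≤ densMeasure g (Iic (S x)) := by
    rw [← hSpush, Measure.map_apply hSm measurableSet_Iic]
    refine measure_mono_ae ?_
    filter_upwards [ae_mem_Icc_densMeasure f] with t ht htx
    exact hSmono ht hx htx
  have hge : densMeasure g (Iic (S x)) ≤ densMeasure f (Iic x) := by
    rw [← densMeasure_Iio, ← hSpush, Measure.map_apply hSm measurableSet_Iio]
    refine measure_mono_ae ?_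
    filter_upwards [ae_mem_Icc_densMeasure f] with t ht htx
    exact (hSmono.reflect_lt ht hx htx).le
  have heq := le_antisymm hge hle
  rw [densMeasure_Iic hfc hfpos hx, densMeasure_Iic hgc hgpos (hSmaps hx)] at heq
  refine (ENNReal.ofReal_eq_ofReal_iff ?_ ?_).1 heq
  · exact intervalIntegral.integral_nonneg (hSmaps hx).1 fun t ht =>
      (hgpos t ⟨ht.1, ht.2.trans (hSmaps hx).2⟩).le
  · exact intervalIntegral.integral_nonneg hx.1 fun t ht => (hfpos t ⟨ht.1, ht.2.trans hx.2⟩).le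

/-- Uniqueness of the monotone transport map: any nondecreasing Borel transport
map `S` from `f` to `g` coincides Lebesgue-a.e. on `[0,1]` with the monotone
rearrangement `T = G⁻¹ ∘ F`. -/
theorem monotone_transport_map_unique
    (f g F G Ginv : ℝ → ℝ)
    (hfc : ContinuousOn f (Icc 0 1)) (hgc : ContinuousOn g (Icc 0 1))
    (hfpos : ∀ x ∈ Icc (0:ℝ) 1, 0 < f x) (hgpos : ∀ x ∈ Icc (0:ℝ) 1, 0 < g x)
    (hf1 : (∫ x in (0:ℝ)..1, f x) = 1) (hg1 : (∫ x in (0:ℝ)..1, g x) = 1)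
    (hF : ∀ x, F x = ∫ t in (0:ℝ)..x, f t) (hG : ∀ y, G y = ∫ t in (0:ℝ)..y, g t)
    (hGinv : ∀ y ∈ Icc (0:ℝ) 1, Ginv y ∈ Icc (0:ℝ) 1 ∧ G (Ginv y) = y)
    (T : ℝ → ℝ) (hT : ∀ x, T x = Ginv (F x))
    (S : ℝ → ℝ) (hSm : Measurable S) (hSmono : MonotoneOn S (Icc (0:ℝ) 1))
    (hSmaps : MapsTo S (Icc 0 1) (Icc 0 1))
    (hSpush : Measure.map S (densMeasure f) = densMeasure g) :
    ∀ᵐ x ∂(volume.restrict (Icc (0:ℝ) 1)), S x = T x := by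
  filter_upwards [ae_restrict_mem measurableSet_Icc] with x hx
  have hGS : G (S x) = F x := by
    rw [hG, hF]
    exact integral_eq_of_monotoneOn_of_map_eq hfc hgc hfpos hgpos hSm hSmono hSmaps hSpush hx
  have hmono := strictMonoOn_integral hfc hfpos
  have hFx : F x ∈ Icc (0:ℝ) 1 := by
    have h0 := hmono.monotoneOn (left_mem_Icc.2 zero_le_one) hx hx.1
    have h1 := hmono.monotoneOn hx (right_mem_Icc.2 zero_le_one) hx.2
    simp only [intervalIntegral.integral_same, hf1, ← hF] at h0 h1
    exact ⟨h0, h1⟩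
  obtain ⟨hmem, hval⟩ := hGinv (F x) hFx
  rw [hT]
  refine (strictMonoOn_integral hgc hgpos).injOn (hSmaps hx) hmem ?_
  simp only [← hG, hGS, hval]
end

section
/- Let T : ℝ → ℝ be a nondecreasing function. Then T is cyclically monotone: for every m ≥ 1 and every finite sequence x₁, …, x_m in ℝ (with the convention x₀ = x_m), ∑_{i=1}^m T(x_i)·(x_i − x_{i−1}) ≥ 0, or equivalently ∑_{i=1}^m |x_i − T(x_i)|² ≤ ∑_{i=1}^m |x_i − T(x_{i−1})|². -/
/-- Composing a monotone map with a family gives a family that monovaries with it. -/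
theorem Monotone.monovary_comp_self {ι α β : Type*} [LinearOrder α] [Preorder β] {T : α → β}
    (hT : Monotone T) (x : ι → α) : Monovary (T ∘ x) x :=
  fun _ _ h => hT h.le

/-- A monotone real map is cyclically monotone along any permutation of a finite family. -/
theorem Monotone.sum_mul_sub_comp_perm_nonneg {ι : Type*} [Fintype ι] {T : ℝ → ℝ}
    (hT : Monotone T) (x : ι → ℝ) (σ : Equiv.Perm ι) :
    0 ≤ ∑ i, T (x i) * (x i - x (σ i)) := by
  have h : ∑ i, T (x i) * x (σ i) ≤ ∑ i, T (x i) * x i :=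
    (hT.monovary_comp_self x).sum_mul_comp_perm_le_sum_mul
  simp only [mul_sub, Finset.sum_sub_distrib]
  linarith

/-- Permuting the targets of a monotone real map does not decrease the quadratic cost. -/
theorem Monotone.sum_sq_abs_sub_le_sum_sq_abs_sub_comp_perm {ι : Type*} [Fintype ι] {T : ℝ → ℝ}
    (hT : Monotone T) (x : ι → ℝ) (σ : Equiv.Perm ι) :
    ∑ i, |x i - T (x i)| ^ 2 ≤ ∑ i, |x i - T (x (σ i))| ^ 2 := by
  have h : ∑ i, x i * T (x (σ i)) ≤ ∑ i, x i * T (x i) :=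
    (hT.monovary_comp_self x).symm.sum_mul_comp_perm_le_sum_mul
  have hσ : ∑ i, T (x (σ i)) ^ 2 = ∑ i, T (x i) ^ 2 :=
    Equiv.sum_comp σ fun i => T (x i) ^ 2
  simp only [sq_abs, sub_sq, mul_assoc, Finset.sum_add_distrib, Finset.sum_sub_distrib,
    ← Finset.mul_sum]
  linarith

/-- A nondecreasing map `T : ℝ → ℝ` is cyclically monotone: for every finite
cyclic sequence `x₁,…,x_m` (with `x₀ = x_m`), `∑ T(xᵢ)·(xᵢ − xᵢ₋₁) ≥ 0`, and
equivalently `∑ |xᵢ − T(xᵢ)|² ≤ ∑ |xᵢ − T(xᵢ₋₁)|²`. -/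
theorem monotone_real_map_is_cyclically_monotone
    (T : ℝ → ℝ) (hT : Monotone T) :
    (∀ m : ℕ, ∀ x : Fin (m + 1) → ℝ, 0 ≤ ∑ i, T (x i) * (x i - x (i - 1))) ∧
      (∀ m : ℕ, ∀ x : Fin (m + 1) → ℝ,
        ∑ i, |x i - T (x i)| ^ 2 ≤ ∑ i, |x i - T (x (i - 1))| ^ 2) := by
  exact ⟨fun _ x => hT.sum_mul_sub_comp_perm_nonneg x (Equiv.subRight 1),
    fun _ x => hT.sum_sq_abs_sub_le_sum_sq_abs_sub_comp_perm x (Equiv.subRight 1)⟩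
end

section
/- Let X ⊆ ℝⁿ be an open convex set, u : ℝⁿ → ℝ a C² function whose Hessian D²u(x) is positive definite for every x ∈ X (so ∇u is injective on X), and let g : ℝⁿ → ℝ be a continuous strictly positive function. Define f : ℝⁿ → ℝ by f(x) = g(∇u(x))·det(D²u(x)) for x ∈ X and f(x) = 0 otherwise. Then the map ∇u transports f to g: for every Borel set B ⊆ ∇u(X), ∫_{(∇u)⁻¹(B) ∩ X} f(x) dx = ∫_B g(y) dy. In other words, a convex potential solving the Monge–Ampère equation det(D²u(x)) = f(x)/g(∇u(x)) yields a mass-preserving map T = ∇u. -/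
open MeasureTheory Set RealInnerProductSpace

/-- A linear endomorphism with positive definite (not necessarily symmetric) quadratic form has
positive determinant. -/
theorem LinearMap.det_pos_of_inner_pos {E : Type*} [NormedAddCommGroup E] [InnerProductSpace ℝ E]
    [FiniteDimensional ℝ E] (A : E →L[ℝ] E) (hA : ∀ v : E, v ≠ 0 → 0 < ⟪A v, v⟫) :
    0 < LinearMap.det A.toLinearMap := by
  let P : ℝ → E →L[ℝ] E := fun t ↦ (1 - t) • ContinuousLinearMap.id ℝ E + t • A
  have hcont : Continuous fun t ↦ (P t).det :=
    ContinuousLinearMap.continuous_det.comp (by fun_prop)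
  have hne : ∀ t ∈ Icc (0 : ℝ) 1, (P t).det ≠ 0 := by
    intro t ht h0
    obtain ⟨v, hv, hv0⟩ := (Submodule.ne_bot_iff _).1 (LinearMap.bot_lt_ker_of_det_eq_zero h0).ne'
    have hPv : (1 - t) • v + t • A v = 0 := by simpa [P] using hv
    have h : (1 - t) * ⟪v, v⟫ + t * ⟪A v, v⟫ = 0 := by
      rw [← real_inner_smul_left, ← real_inner_smul_left, ← inner_add_left, hPv, inner_zero_left]
    have hvv : 0 < ⟪v, v⟫ := real_inner_self_pos.2 hv0
    have hAv := hA v hv0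
    have h1 := mul_nonneg (sub_nonneg.2 ht.2) hvv.le
    have h2 := mul_nonneg ht.1 hAv.le
    rcases ht.1.eq_or_lt with h3 | h3
    · subst h3
      linarith
    · linarith [mul_pos h3 hAv]
  by_contra! hle
  have hP0 : (P 0).det = 1 := by simp [P, ContinuousLinearMap.det]
  have hP1 : (P 1).det = LinearMap.det A.toLinearMap := by simp [P, ContinuousLinearMap.det]
  obtain ⟨t, ht, h0⟩ := intermediate_value_Icc' zero_le_one hcont.continuousOn
    (show (0 : ℝ) ∈ Icc (P 1).det (P 0).det from ⟨hP1.trans_le hle, by rw [hP0]; exact zero_le_one⟩)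
  exact hne t ht h0

/-- A map whose derivative has positive definite quadratic form on a convex set is injective
there. -/
theorem Convex.injOn_of_inner_fderiv_pos {E : Type*} [NormedAddCommGroup E]
    [InnerProductSpace ℝ E] {s : Set E} (hs : Convex ℝ s) {T : E → E} {T' : E → E →L[ℝ] E}
    (hT : ∀ x ∈ s, HasFDerivAt T (T' x) x)
    (hpos : ∀ x ∈ s, ∀ v : E, v ≠ 0 → 0 < ⟪T' x v, v⟫) : InjOn T s := by
  intro x hx y hy hxy
  by_contra hne
  have hv : y - x ≠ 0 := sub_ne_zero.2 (Ne.symm hne)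
  have hmem : ∀ t ∈ Icc (0 : ℝ) 1, x + t • (y - x) ∈ s := fun t ht ↦
    hs.add_smul_sub_mem hx hy ht
  have hderiv : ∀ t ∈ Icc (0 : ℝ) 1, HasDerivAt (fun t : ℝ ↦ ⟪T (x + t • (y - x)), y - x⟫)
      ⟪T' (x + t • (y - x)) (y - x), y - x⟫ t := by
    intro t ht
    have hline : HasDerivAt (fun t : ℝ ↦ x + t • (y - x)) (y - x) t := by
      simpa using ((hasDerivAt_id t).smul_const (y - x)).const_add x
    simpa using ((hT _ (hmem t ht)).comp_hasDerivAt t hline).inner ℝ (hasDerivAt_const t (y - x))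
  obtain ⟨c, hc, heq⟩ := exists_hasDerivAt_eq_slope _ _ zero_lt_one
    (fun t ht ↦ (hderiv t ht).continuousAt.continuousWithinAt)
    (fun t ht ↦ hderiv t (Ioo_subset_Icc_self ht))
  have hc' := hpos _ (hmem c (Ioo_subset_Icc_self hc)) _ hv
  have hzero : ⟪T' (x + c • (y - x)) (y - x), y - x⟫ = 0 := by
    rw [heq]
    simp [hxy]
  exact hc'.ne' hzero

/-- A convex potential solving the Monge–Ampère equation yields a
mass-preserving map.  Let `X ⊆ ℝⁿ` be open and convex, `u` a `C²` function with
gradient `Du` and Hessian `Hu` positive definite on `X`, `g` continuous and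
strictly positive, and define `f = g(∇u)·det(D²u)` on `X`, `f = 0` outside.
Then `∇u` transports `f` to `g`: for every Borel `B ⊆ ∇u(X)`,
`∫_{(∇u)⁻¹(B) ∩ X} f = ∫_B g`. -/
theorem monge_ampere_solution_is_mass_preserving (n : ℕ)
    (X : Set (EuclideanSpace ℝ (Fin n))) (hXopen : IsOpen X) (hXconv : Convex ℝ X)
    (u : EuclideanSpace ℝ (Fin n) → ℝ) (hu : ContDiff ℝ 2 u)
    (Du : EuclideanSpace ℝ (Fin n) → EuclideanSpace ℝ (Fin n))
    (hDu : ∀ x, HasGradientAt u (Du x) x)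
    (Hu : EuclideanSpace ℝ (Fin n) →
      EuclideanSpace ℝ (Fin n) →L[ℝ] EuclideanSpace ℝ (Fin n))
    (hHu : ∀ x, HasFDerivAt Du (Hu x) x)
    (hHupos : ∀ x ∈ X, ∀ v : EuclideanSpace ℝ (Fin n), v ≠ 0 → 0 < ⟪(Hu x) v, v⟫)
    (g : EuclideanSpace ℝ (Fin n) → ℝ) (hgc : Continuous g) (hgpos : ∀ y, 0 < g y)
    (f : EuclideanSpace ℝ (Fin n) → ℝ)
    (hfin : ∀ x ∈ X, f x = g (Du x) * LinearMap.det (Hu x).toLinearMap)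
    (hfout : ∀ x ∉ X, f x = 0) :
    ∀ B ⊆ Du '' X, MeasurableSet B →
      (∫ x in Du ⁻¹' B ∩ X, f x) = ∫ y in B, g y := by
  intro B hB hBm
  have hDum : Measurable Du :=
    (continuous_iff_continuousAt.2 fun x ↦ (hHu x).continuousAt).measurable
  have hS : MeasurableSet (Du ⁻¹' B ∩ X) := (hDum hBm).inter hXopen.measurableSet
  have hinj : InjOn Du (Du ⁻¹' B ∩ X) :=
    (hXconv.injOn_of_inner_fderiv_pos (fun x _ ↦ hHu x) hHupos).mono inter_subset_right
  have himage : Du '' (Du ⁻¹' B ∩ X) = B := by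
    rw [image_preimage_inter, inter_eq_left.2 hB]
  have hcov := integral_image_eq_integral_abs_det_fderiv_smul volume hS
    (fun x _ ↦ (hHu x).hasFDerivWithinAt) hinj g
  rw [himage] at hcov
  rw [hcov]
  refine setIntegral_congr_fun hS fun x hx ↦ ?_
  have hdet : 0 < (Hu x).det := LinearMap.det_pos_of_inner_pos (Hu x) (hHupos x hx.2)
  simp only [hfin x hx.2, abs_of_pos hdet, smul_eq_mul]
  exact mul_comm _ _
end

section
/- Let f and g be continuous probability density functions on [0,1] with g(y) ≥ m > 0 for all y ∈ [0,1], and let F and G be their cumulative distribution functions. Then the quadratic transport cost of the monotone rearrangement T = G⁻¹ ∘ F satisfies ∫₀¹ |x − G⁻¹(F(x))|² f(x) dx ≤ (sup_{x∈[0,1]} |F(x) − G(x)|)² / m². Consequently the squared quadratic Wasserstein distance obeys W₂²(f,g) ≤ ‖F − G‖²_∞ / m². -/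
open MeasureTheory Set

/-- The cumulative distribution function of a density bounded below by `k` on `[0,1]` grows at
rate at least `k`. -/
lemma mul_sub_le_primitive_sub {h : ℝ → ℝ} {k a b : ℝ} (hc : ContinuousOn h (Icc 0 1))
    (hk : ∀ x ∈ Icc (0:ℝ) 1, k ≤ h x) (ha : 0 ≤ a) (hab : a ≤ b) (hb : b ≤ 1) :
    k * (b - a) ≤ (∫ t in (0:ℝ)..b, h t) - ∫ t in (0:ℝ)..a, h t := by
  have hint : ∀ c d : ℝ, 0 ≤ c → c ≤ d → d ≤ 1 → IntervalIntegrable h volume c d := by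
    intro c d h0 hcd h1
    refine (hc.mono ?_).intervalIntegrable
    rw [uIcc_of_le hcd]
    exact Icc_subset_Icc h0 h1
  rw [intervalIntegral.integral_interval_sub_left (hint 0 b le_rfl (ha.trans hab) hb)
    (hint 0 a le_rfl ha (hab.trans hb))]
  have hmono := intervalIntegral.integral_mono_on hab (f := fun _ => k) (g := h)
    intervalIntegrable_const (hint a b ha hab hb)
    fun x hx => hk x ⟨ha.trans hx.1, hx.2.trans hb⟩
  rw [intervalIntegral.integral_const, smul_eq_mul] at hmono
  linarith

lemma densMeasure_Iic_s15 {h : ℝ → ℝ} (hc : ContinuousOn h (Icc 0 1))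
    (h0 : ∀ x ∈ Icc (0:ℝ) 1, 0 ≤ h x) {c : ℝ} (hc0 : 0 ≤ c) (hc1 : c ≤ 1) :
    densMeasure h (Iic c) = ENNReal.ofReal (∫ t in (0:ℝ)..c, h t) := by
  have hset : Iic c ∩ Icc (0:ℝ) 1 = Icc 0 c := by
    ext x
    simp only [mem_inter_iff, mem_Iic, mem_Icc]
    exact ⟨fun hx => ⟨hx.2.1, hx.1⟩, fun hx => ⟨hx.2, hx.1, hx.2.trans hc1⟩⟩
  have hsub : Icc (0:ℝ) c ⊆ Icc 0 1 := Icc_subset_Icc le_rfl hc1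
  rw [densMeasure, withDensity_apply _ measurableSet_Iic,
    Measure.restrict_restrict measurableSet_Iic, hset, intervalIntegral.integral_of_le hc0,
    ← integral_Icc_eq_integral_Ioc,
    ofReal_integral_eq_lintegral_ofReal ((hc.mono hsub).integrableOn_Icc)]
  exact (ae_restrict_mem measurableSet_Icc).mono fun x hx => h0 x (hsub hx)

lemma densMeasure_congr_set (h : ℝ → ℝ) {s t : Set ℝ} (hst : ∀ x ∈ Icc (0:ℝ) 1, x ∈ s ↔ x ∈ t) :
    densMeasure h s = densMeasure h t := by
  have hac : densMeasure h ≪ volume.restrict (Icc (0:ℝ) 1) := withDensity_absolutelyContinuous _ _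
  refine measure_congr (hac.ae_le ?_)
  filter_upwards [ae_restrict_mem measurableSet_Icc] with x hx
  exact propext (hst x hx)

lemma isFiniteMeasure_densMeasure {h : ℝ → ℝ} (hc : ContinuousOn h (Icc 0 1)) :
    IsFiniteMeasure (densMeasure h) :=
  isFiniteMeasure_withDensity_ofReal hc.integrableOn_Icc.2

/-- A map `S` into `[0,1]` with `G ∘ S = F` on `[0,1]` transports the density `f` to `g`. -/
lemma map_densMeasure_eq {f g F G S : ℝ → ℝ}
    (hfc : ContinuousOn f (Icc 0 1)) (hgc : ContinuousOn g (Icc 0 1))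
    (hf0 : ∀ x ∈ Icc (0:ℝ) 1, 0 ≤ f x) (hg0 : ∀ y ∈ Icc (0:ℝ) 1, 0 ≤ g y)
    (hf1 : (∫ x in (0:ℝ)..1, f x) = 1) (hg1 : (∫ x in (0:ℝ)..1, g x) = 1)
    (hF : ∀ x, F x = ∫ t in (0:ℝ)..x, f t) (hG : ∀ y, G y = ∫ t in (0:ℝ)..y, g t)
    (hFmono : MonotoneOn F (Icc 0 1)) (hGmono : StrictMonoOn G (Icc 0 1)) (hS : Measurable S)
    (hSmem : MapsTo S (Icc 0 1) (Icc 0 1)) (hGS : ∀ x ∈ Icc (0:ℝ) 1, G (S x) = F x) :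
    Measure.map S (densMeasure f) = densMeasure g := by
  have := isFiniteMeasure_densMeasure hfc
  have := isFiniteMeasure_densMeasure hgc
  have hFcont : ContinuousOn F (Icc 0 1) := by
    have hprim := intervalIntegral.continuousOn_primitive_interval (μ := volume) (f := f)
      (a := 0) (b := 1) (by rw [uIcc_of_le zero_le_one]; exact hfc.integrableOn_Icc)
    rw [uIcc_of_le zero_le_one] at hprim
    exact hprim.congr fun x _ => hF x
  have hF0 : F 0 = 0 := by rw [hF, intervalIntegral.integral_same]
  have hF1 : F 1 = 1 := by rw [hF, hf1]
  have hG0 : G 0 = 0 := by rw [hG, intervalIntegral.integral_same]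
  have hG1 : G 1 = 1 := by rw [hG, hg1]
  have h0mem : (0:ℝ) ∈ Icc (0:ℝ) 1 := left_mem_Icc.2 zero_le_one
  have h1mem : (1:ℝ) ∈ Icc (0:ℝ) 1 := right_mem_Icc.2 zero_le_one
  refine Measure.ext_of_Iic _ _ fun a => ?_
  rw [Measure.map_apply hS measurableSet_Iic]
  rcases lt_or_ge a 0 with ha0 | ha0
  · rw [densMeasure_congr_set f (t := ∅), densMeasure_congr_set g (t := ∅), measure_empty,
      measure_empty]
    · exact fun x hx => iff_of_false (fun h => (ha0.trans_le hx.1).not_ge h) (notMem_empty x)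
    · exact fun x hx => iff_of_false (fun h => (ha0.trans_le (hSmem hx).1).not_ge h)
        (notMem_empty x)
  rcases lt_or_ge 1 a with ha1 | ha1
  · rw [densMeasure_congr_set f (t := Iic 1), densMeasure_congr_set g (t := Iic 1),
      densMeasure_Iic_s15 hfc hf0 zero_le_one le_rfl, densMeasure_Iic_s15 hgc hg0 zero_le_one le_rfl,
      hf1, hg1]
    · exact fun x hx => iff_of_true (hx.2.trans ha1.le) hx.2
    · exact fun x hx => iff_of_true ((hSmem hx).2.trans ha1.le) hx.2
  have ha : a ∈ Icc (0:ℝ) 1 := ⟨ha0, ha1⟩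
  have hGa : G a ∈ Icc (F 0) (F 1) := by
    rw [hF0, hF1, ← hG0, ← hG1]
    exact ⟨hGmono.monotoneOn h0mem ha ha0, hGmono.monotoneOn ha h1mem ha1⟩
  obtain ⟨c, ⟨hc, hFc⟩, hcmax⟩ : ∃ c, IsGreatest (Icc 0 1 ∩ F ⁻¹' {G a}) c := by
    refine IsCompact.exists_isGreatest ?_ (intermediate_value_Icc zero_le_one hFcont hGa)
    exact isCompact_Icc.of_isClosed_subset
      (hFcont.preimage_isClosed_of_isClosed isClosed_Icc isClosed_singleton) inter_subset_left
  have hFc' : F c = G a := hFc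
  rw [densMeasure_congr_set f (t := Iic c), densMeasure_Iic_s15 hfc hf0 hc.1 hc.2,
    densMeasure_Iic_s15 hgc hg0 ha0 ha1, ← hF, ← hG, hFc']
  intro x hx
  rw [mem_preimage, mem_Iic, mem_Iic, ← hGmono.le_iff_le (hSmem hx) ha, hGS x hx, ← hFc']
  refine ⟨fun hle => ?_, fun hle => hFmono hx hc hle⟩
  by_contra! hlt
  exact hlt.not_ge (hcmax ⟨hx, (le_antisymm hle (hFmono hc hx hlt.le)).trans hFc'⟩)

/-- Bound of the quadratic transport cost by the sup-distance of CDFs: if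
`g ≥ m > 0`, then the cost of the monotone rearrangement `G⁻¹ ∘ F` is at most
`‖F − G‖²_∞ / m²`, and consequently `W₂²(f,g)` (the infimum of transport costs
over all Borel transport maps from `f` to `g`) obeys the same bound. -/
theorem w2_bound_by_sup_cdf_difference
    (m : ℝ) (hm : 0 < m)
    (f g F G Ginv : ℝ → ℝ)
    (hfc : ContinuousOn f (Icc 0 1)) (hgc : ContinuousOn g (Icc 0 1))
    (hf0 : ∀ x ∈ Icc (0:ℝ) 1, 0 ≤ f x) (hgm : ∀ y ∈ Icc (0:ℝ) 1, m ≤ g y)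
    (hf1 : (∫ x in (0:ℝ)..1, f x) = 1) (hg1 : (∫ x in (0:ℝ)..1, g x) = 1)
    (hF : ∀ x, F x = ∫ t in (0:ℝ)..x, f t) (hG : ∀ y, G y = ∫ t in (0:ℝ)..y, g t)
    (hGinv : ∀ y ∈ Icc (0:ℝ) 1, Ginv y ∈ Icc (0:ℝ) 1 ∧ G (Ginv y) = y) :
    ((∫ x in (0:ℝ)..1, |x - Ginv (F x)| ^ 2 * f x) ≤
        (⨆ x : Icc (0:ℝ) 1, |F x.1 - G x.1|) ^ 2 / m ^ 2) ∧
      sInf {c : ℝ | ∃ S : ℝ → ℝ, Measurable S ∧ MapsTo S (Icc 0 1) (Icc 0 1) ∧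
          Measure.map S (densMeasure f) = densMeasure g ∧
          c = ∫ x in (0:ℝ)..1, |x - S x| ^ 2 * f x} ≤
        (⨆ x : Icc (0:ℝ) 1, |F x.1 - G x.1|) ^ 2 / m ^ 2 := by
  have hsub := fun {a b : ℝ} => mul_sub_le_primitive_sub (a := a) (b := b) hgc hgm
  simp only [← hG] at hsub
  have hGmono : StrictMonoOn G (Icc 0 1) := by
    intro a ha b hb hab
    have := hsub ha.1 hab.le hb.2
    have := mul_pos hm (sub_pos.2 hab)
    linarith
  have hFmono : MonotoneOn F (Icc 0 1) := by
    intro a ha b hb hab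
    have := mul_sub_le_primitive_sub hfc hf0 ha.1 hab hb.2
    rw [hF, hF]
    linarith
  have h0mem : (0:ℝ) ∈ Icc (0:ℝ) 1 := left_mem_Icc.2 zero_le_one
  have h1mem : (1:ℝ) ∈ Icc (0:ℝ) 1 := right_mem_Icc.2 zero_le_one
  have hFmem : MapsTo F (Icc 0 1) (Icc 0 1) := by
    intro x hx
    have h0 := hFmono h0mem hx hx.1
    have h1 := hFmono hx h1mem hx.2
    rw [hF 0, intervalIntegral.integral_same] at h0
    rw [hF 1, hf1] at h1
    exact ⟨h0, h1⟩
  have hGmem : MapsTo G (Icc 0 1) (Icc 0 1) := by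
    intro x hx
    have h0 := hGmono.monotoneOn h0mem hx hx.1
    have h1 := hGmono.monotoneOn hx h1mem hx.2
    rw [hG 0, intervalIntegral.integral_same] at h0
    rw [hG 1, hg1] at h1
    exact ⟨h0, h1⟩
  set D := ⨆ x : Icc (0:ℝ) 1, |F x.1 - G x.1|
  have hbdd : BddAbove (range fun x : Icc (0:ℝ) 1 => |F x.1 - G x.1|) := by
    refine ⟨1, ?_⟩
    rintro _ ⟨x, rfl⟩
    have h1 := hFmem x.2
    have h2 := hGmem x.2
    exact abs_sub_le_iff.2 ⟨by linarith [h1.2, h2.1], by linarith [h1.1, h2.2]⟩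
  have hdist : ∀ a ∈ Icc (0:ℝ) 1, ∀ b ∈ Icc (0:ℝ) 1, m * |a - b| ≤ |G b - G a| := by
    intro a ha b hb
    rcases le_total a b with hab | hab
    · rw [abs_sub_comm, abs_of_nonneg (sub_nonneg.2 hab)]
      exact (hsub ha.1 hab hb.2).trans (le_abs_self _)
    · rw [abs_of_nonneg (sub_nonneg.2 hab), abs_sub_comm]
      exact (hsub hb.1 hab ha.2).trans (le_abs_self _)
  have hpt : ∀ x ∈ Icc (0:ℝ) 1, |x - Ginv (F x)| ≤ D / m := by
    intro x hx
    obtain ⟨hmem, heq⟩ := hGinv (F x) (hFmem hx)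
    have h := hdist x hx _ hmem
    rw [heq] at h
    rw [le_div_iff₀ hm, mul_comm]
    exact h.trans (le_ciSup hbdd ⟨x, hx⟩)
  have hcost : (∫ x in (0:ℝ)..1, |x - Ginv (F x)| ^ 2 * f x) ≤ D ^ 2 / m ^ 2 := by
    calc (∫ x in (0:ℝ)..1, |x - Ginv (F x)| ^ 2 * f x)
        ≤ ∫ x in (0:ℝ)..1, (D / m) ^ 2 * f x := by
          simp only [intervalIntegral.integral_of_le zero_le_one, ← integral_Icc_eq_integral_Ioc]
          refine integral_mono_of_nonneg ?_ (hfc.integrableOn_Icc.const_mul _) ?_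
          · filter_upwards [ae_restrict_mem measurableSet_Icc] with x hx
            exact mul_nonneg (sq_nonneg _) (hf0 x hx)
          · filter_upwards [ae_restrict_mem measurableSet_Icc] with x hx
            exact mul_le_mul_of_nonneg_right
              (pow_le_pow_left₀ (abs_nonneg _) (hpt x hx) 2) (hf0 x hx)
      _ = D ^ 2 / m ^ 2 := by
          rw [intervalIntegral.integral_const_mul, hf1, mul_one, div_pow]
  refine ⟨hcost, le_trans (csInf_le ?_ ?_) hcost⟩
  · refine ⟨0, ?_⟩
    rintro _ ⟨S, -, -, -, rfl⟩
    exact intervalIntegral.integral_nonneg zero_le_one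
      fun x hx => mul_nonneg (sq_nonneg _) (hf0 x hx)
  let S : ℝ → ℝ := fun x => Ginv (F (projIcc 0 1 zero_le_one x))
  have hSeq : ∀ x ∈ Icc (0:ℝ) 1, S x = Ginv (F x) := by
    intro x hx
    simp only [S, projIcc_of_mem zero_le_one hx]
  have hSspec : ∀ x, S x ∈ Icc (0:ℝ) 1 ∧ G (S x) = F (projIcc 0 1 zero_le_one x) :=
    fun x => hGinv _ (hFmem (projIcc 0 1 zero_le_one x).2)
  have hSmono : Monotone S := by
    intro x y hxy
    rw [← hGmono.le_iff_le (hSspec x).1 (hSspec y).1, (hSspec x).2, (hSspec y).2]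
    exact hFmono (Subtype.coe_prop _) (Subtype.coe_prop _) (monotone_projIcc _ hxy)
  refine ⟨S, hSmono.measurable, fun x _ => (hSspec x).1, ?_, ?_⟩
  · refine map_densMeasure_eq hfc hgc hf0 (fun y hy => hm.le.trans (hgm y hy)) hf1 hg1 hF hG
      hFmono hGmono hSmono.measurable (fun x _ => (hSspec x).1) fun x hx => ?_
    rw [(hSspec x).2, projIcc_of_mem zero_le_one hx]
  · refine intervalIntegral.integral_congr fun x hx => ?_
    rw [uIcc_of_le zero_le_one] at hx
    simp only [hSeq x hx]
end

section
/- Let f and g be continuous, strictly positive probability densities on [0,1] with cumulative distribution functions F and G, and let φ : [0,1] → ℝ be continuous with ∫₀¹ φ(t) dt = 0; set Φ(t) = ∫₀ᵗ φ(τ) dτ. Then there exists ε₀ > 0 such that for all |ε| < ε₀ one has f + εφ ≥ 0 and F(t) + εΦ(t) ∈ [0,1] for all t, and the perturbed transport cost W(ε) = ∫₀¹ |t − G⁻¹(F(t) + εΦ(t))|² (f(t) + εφ(t)) dt is differentiable at ε = 0 with derivative W′(0) = ∫₀¹ [ ∫_t¹ −2 (s − G⁻¹(F(s))) · (f(s)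 / g(G⁻¹(F(s)))) ds + |t − G⁻¹(F(t))|² ] φ(t) dt. This is the first variation (Fréchet derivative) of the one-dimensional squared quadratic Wasserstein metric with respect to the synthetic data f. -/
open MeasureTheory Set

/-- The primitive of a continuous function bounded below by a positive constant has a global
differentiable inverse. -/
theorem exists_hasDerivAt_inverse_of_primitive {g : ℝ → ℝ} (hg : Continuous g) {c : ℝ}
    (hc : 0 < c) (hcg : ∀ x, c ≤ g x) :
    ∃ H : ℝ → ℝ, (∀ x, H (∫ t in (0:ℝ)..x, g t) = x) ∧ ∀ y, HasDerivAt H (g (H y))⁻¹ y := by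
  have hint (a b : ℝ) : IntervalIntegrable g volume a b := hg.intervalIntegrable a b
  have hderiv (x : ℝ) : HasDerivAt (fun x => ∫ t in (0:ℝ)..x, g t) (g x) x :=
    intervalIntegral.integral_hasDerivAt_right (hint _ _)
      (hg.stronglyMeasurableAtFilter _ _) hg.continuousAt
  have hlower {a b : ℝ} (hab : a ≤ b) : c * (b - a) ≤ ∫ t in a..b, g t := by
    have h := intervalIntegral.integral_mono_on hab
      (intervalIntegrable_const (c := c)) (hint a b) (fun x _ => hcg x)
    simpa [mul_comm] using h
  have hmono : StrictMono (fun x => ∫ t in (0:ℝ)..x, g t) :=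
    strictMono_of_hasDerivAt_pos hderiv fun x => hc.trans_le (hcg x)
  have hcont : Continuous (fun x => ∫ t in (0:ℝ)..x, g t) :=
    continuous_iff_continuousAt.2 fun x => (hderiv x).continuousAt
  have hsurj : Function.Surjective (fun x => ∫ t in (0:ℝ)..x, g t) := by
    refine hcont.surjective ?_ ?_
    · refine Filter.tendsto_atTop_mono' _ ?_ (Filter.tendsto_id.const_mul_atTop hc)
      filter_upwards [Filter.eventually_ge_atTop 0] with x hx
      simpa using hlower hx
    · refine Filter.tendsto_atBot_mono' _ ?_ (Filter.tendsto_id.const_mul_atBot hc)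
      filter_upwards [Filter.eventually_le_atBot 0] with x hx
      have h := hlower hx
      rw [intervalIntegral.integral_symm x 0]
      simp only [id]
      linarith
  let e := hmono.orderIsoOfSurjective _ hsurj
  refine ⟨e.symm, fun x => e.symm_apply_apply x, fun y => ?_⟩
  exact HasDerivAt.of_local_left_inverse e.symm.continuous.continuousAt (hderiv _)
    (hc.trans_le (hcg _)).ne' (Filter.Eventually.of_forall e.apply_symm_apply)

/-- Differentiation under the integral sign for an integrand with jointly continuous derivative. -/
theorem hasDerivAt_intervalIntegral_of_continuous_deriv {K K' : ℝ → ℝ → ℝ}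
    (hK : Continuous (Function.uncurry K)) (hK' : Continuous (Function.uncurry K'))
    (hderiv : ∀ x t, HasDerivAt (fun x => K x t) (K' x t) x) (a b x₀ : ℝ) :
    HasDerivAt (fun x => ∫ t in a..b, K x t) (∫ t in a..b, K' x₀ t) x₀ := by
  obtain ⟨C, hC⟩ := ((isCompact_closedBall x₀ 1).prod isCompact_uIcc).exists_bound_of_continuousOn
    (s := Metric.closedBall x₀ 1 ×ˢ uIcc a b) hK'.continuousOn
  have hslice (x : ℝ) : Continuous (K x) := hK.comp (Continuous.prodMk_right x)
  have hslice' (x : ℝ) : Continuous (K' x) := hK'.comp (Continuous.prodMk_right x)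
  refine (intervalIntegral.hasDerivAt_integral_of_dominated_loc_of_deriv_le
    (bound := fun _ => C) (Metric.ball_mem_nhds x₀ one_pos)
    (Filter.Eventually.of_forall fun x => (hslice x).aestronglyMeasurable)
    ((hslice x₀).intervalIntegrable a b) (hslice' x₀).aestronglyMeasurable
    (Filter.Eventually.of_forall fun t ht x hx => ?_) intervalIntegrable_const
    (Filter.Eventually.of_forall fun t _ x _ => hderiv x t)).2
  exact hC (x, t) ⟨Metric.ball_subset_closedBall hx, uIoc_subset_uIcc ht⟩

/-- Integration by parts moving a primitive from one factor to the other. -/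
theorem integral_mul_primitive_eq {u v : ℝ → ℝ} (hu : Continuous u) (hv : Continuous v)
    (a b : ℝ) :
    ∫ t in a..b, u t * ∫ s in a..t, v s = ∫ t in a..b, (∫ s in t..b, u s) * v t := by
  have h := intervalIntegral.integral_mul_deriv_eq_deriv_mul (a := a) (b := b)
    (u := fun t => ∫ s in t..b, u s) (u' := fun t => -u t)
    (v := fun t => ∫ s in a..t, v s) (v' := v)
    (fun t _ => intervalIntegral.integral_hasDerivAt_left (hu.intervalIntegrable _ _)
      (hu.stronglyMeasurableAtFilter _ _) hu.continuousAt)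
    (fun t _ => intervalIntegral.integral_hasDerivAt_right (hv.intervalIntegrable _ _)
      (hv.stronglyMeasurableAtFilter _ _) hv.continuousAt)
    (hu.neg.intervalIntegrable _ _) (hv.intervalIntegrable _ _)
  rw [h]
  simp

/-- The first variation formula for globally continuous data and a global inverse `H`. -/
theorem hasDerivAt_transport_cost {f φ H H' : ℝ → ℝ} (hf : Continuous f) (hφ : Continuous φ)
    (hH : ∀ y, HasDerivAt H (H' y) y) (hH' : Continuous H') {F : ℝ → ℝ} (hF : Continuous F) :
    HasDerivAt
      (fun ε : ℝ => ∫ t in (0:ℝ)..1,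
        (t - H (F t + ε * ∫ s in (0:ℝ)..t, φ s)) ^ 2 * (f t + ε * φ t))
      (∫ t in (0:ℝ)..1,
        ((∫ s in t..(1:ℝ), -2 * (s - H (F s)) * (f s * H' (F s))) + (t - H (F t)) ^ 2) * φ t)
      0 := by
  have hHc : Continuous H := continuous_iff_continuousAt.2 fun y => (hH y).continuousAt
  have hΦ : Continuous (fun t => ∫ s in (0:ℝ)..t, φ s) :=
    intervalIntegral.continuous_primitive (fun _ _ => hφ.intervalIntegrable _ _) 0
  set Φ : ℝ → ℝ := fun t => ∫ s in (0:ℝ)..t, φ s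
  have key := hasDerivAt_intervalIntegral_of_continuous_deriv
    (K := fun ε t => (t - H (F t + ε * Φ t)) ^ 2 * (f t + ε * φ t))
    (K' := fun ε t => 2 * (t - H (F t + ε * Φ t)) * (-(H' (F t + ε * Φ t) * Φ t)) *
      (f t + ε * φ t) + (t - H (F t + ε * Φ t)) ^ 2 * φ t)
    (by simp only [Function.uncurry_def]; fun_prop)
    (by simp only [Function.uncurry_def]; fun_prop)
    (fun ε t => by
      have h₁ : HasDerivAt (fun ε => F t + ε * Φ t) (Φ t) ε := by
        simpa using ((hasDerivAt_id ε).mul_const (Φ t)).const_add (F t)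
      have h₂ : HasDerivAt (fun ε => f t + ε * φ t) (φ t) ε := by
        simpa using ((hasDerivAt_id ε).mul_const (φ t)).const_add (f t)
      have h₃ := ((((hH (F t + ε * Φ t)).comp ε h₁).const_sub t).pow 2).mul h₂
      refine h₃.congr_deriv ?_
      simp) 0 1 0
  refine key.congr_deriv ?_
  have hu : Continuous (fun s => -2 * (s - H (F s)) * (f s * H' (F s))) := by fun_prop
  have hA : Continuous (fun t => ∫ s in t..(1:ℝ), -2 * (s - H (F s)) * (f s * H' (F s))) := by
    simp_rw [fun t => intervalIntegral.integral_symm (μ := volume)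
      (f := fun s => -2 * (s - H (F s)) * (f s * H' (F s))) 1 t]
    exact (intervalIntegral.continuous_primitive (fun _ _ => hu.intervalIntegrable _ _) 1).neg
  have hparts : ∫ t in (0:ℝ)..1, -2 * (t - H (F t)) * (f t * H' (F t)) * Φ t =
      ∫ t in (0:ℝ)..1, (∫ s in t..(1:ℝ), -2 * (s - H (F s)) * (f s * H' (F s))) * φ t :=
    integral_mul_primitive_eq hu hφ 0 1
  simp_rw [add_mul]
  symm
  rw [intervalIntegral.integral_add (by apply Continuous.intervalIntegrable; fun_prop)
    (by apply Continuous.intervalIntegrable; fun_prop), ← hparts,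
    ← intervalIntegral.integral_add (by apply Continuous.intervalIntegrable; fun_prop)
    (by apply Continuous.intervalIntegrable; fun_prop)]
  refine intervalIntegral.integral_congr fun t _ => ?_
  simp only [zero_mul, add_zero]
  ring

/-- A continuous strictly positive density on `[0,1]` stays nonnegative, with cumulative
distribution function valued in `[0,1]`, under small continuous perturbations of zero mean. -/
theorem exists_perturbed_density_mem {f φ : ℝ → ℝ} (hf : ContinuousOn f (Icc 0 1))
    (hfpos : ∀ x ∈ Icc (0:ℝ) 1, 0 < f x) (hf1 : ∫ x in (0:ℝ)..1, f x = 1)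
    (hφ : ContinuousOn φ (Icc 0 1)) (hφ0 : ∫ t in (0:ℝ)..1, φ t = 0) :
    ∃ ε₀ > (0:ℝ), ∀ ε : ℝ, |ε| < ε₀ →
      (∀ t ∈ Icc (0:ℝ) 1, 0 ≤ f t + ε * φ t) ∧
      ∀ t ∈ Icc (0:ℝ) 1,
        (∫ s in (0:ℝ)..t, f s) + ε * (∫ s in (0:ℝ)..t, φ s) ∈ Icc (0:ℝ) 1 := by
  obtain ⟨x₀, hx₀, hmin⟩ := isCompact_Icc.exists_isMinOn (nonempty_Icc.2 zero_le_one) hf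
  obtain ⟨M, hM⟩ := isCompact_Icc.exists_bound_of_continuousOn hφ
  have hM0 : 0 ≤ M := (norm_nonneg _).trans (hM 0 (by simp))
  refine ⟨f x₀ / (M + 1), div_pos (hfpos _ hx₀) (by linarith), fun ε hε => ?_⟩
  rw [lt_div_iff₀ (by linarith)] at hε
  have hnonneg : ∀ t ∈ Icc (0:ℝ) 1, 0 ≤ f t + ε * φ t := fun t ht => by
    have h₁ : |ε * φ t| ≤ |ε| * M := by
      rw [abs_mul]
      exact mul_le_mul_of_nonneg_left (hM t ht) (abs_nonneg _)
    have h₂ : f x₀ ≤ f t := hmin ht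
    linarith [neg_abs_le (ε * φ t), abs_nonneg ε]
  refine ⟨hnonneg, fun t ht => ?_⟩
  have hint {u : ℝ → ℝ} (hu : ContinuousOn u (Icc 0 1)) {a b : ℝ} (ha : a ∈ Icc (0:ℝ) 1)
      (hb : b ∈ Icc (0:ℝ) 1) : IntervalIntegrable u volume a b :=
    (hu.mono (ordConnected_Icc.uIcc_subset ha hb)).intervalIntegrable
  have hadd {a b : ℝ} (ha : a ∈ Icc (0:ℝ) 1) (hb : b ∈ Icc (0:ℝ) 1) :
      (∫ s in a..b, f s) + ε * (∫ s in a..b, φ s) = ∫ s in a..b, f s + ε * φ s := by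
    rw [intervalIntegral.integral_add (hint hf ha hb) ((hint hφ ha hb).const_mul ε),
      intervalIntegral.integral_const_mul]
  have h0 : (0:ℝ) ∈ Icc (0:ℝ) 1 := by simp
  have h1 : (1:ℝ) ∈ Icc (0:ℝ) 1 := by simp
  have hleft : 0 ≤ ∫ s in (0:ℝ)..t, f s + ε * φ s :=
    intervalIntegral.integral_nonneg ht.1 fun s hs => hnonneg s ⟨hs.1, hs.2.trans ht.2⟩
  have hright : 0 ≤ ∫ s in t..(1:ℝ), f s + ε * φ s :=
    intervalIntegral.integral_nonneg ht.2 fun s hs => hnonneg s ⟨ht.1.trans hs.1, hs.2⟩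
  rw [← hadd h0 ht] at hleft
  rw [← hadd ht h1] at hright
  have e₁ := intervalIntegral.integral_add_adjacent_intervals (hint hf h0 ht) (hint hf ht h1)
  have e₂ := intervalIntegral.integral_add_adjacent_intervals (hint hφ h0 ht) (hint hφ ht h1)
  rw [hf1] at e₁
  rw [hφ0] at e₂
  refine ⟨hleft, ?_⟩
  rw [← eq_sub_iff_add_eq'] at e₁ e₂
  rw [e₁, e₂] at hright
  linarith

/-- First variation (Fréchet derivative) of the 1D squared quadratic
Wasserstein metric with respect to the synthetic data.  Let `f, g` be
continuous strictly positive probability densities on `[0,1]` with CDFs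
`F, G`, let `φ` be continuous with zero mean and `Φ(t) = ∫₀ᵗ φ`.  Then for
sufficiently small `ε` the perturbation `f + εφ` remains nonnegative with
`F + εΦ ∈ [0,1]`, and the perturbed transport cost
`W(ε) = ∫₀¹ |t − G⁻¹(F(t)+εΦ(t))|² (f(t)+εφ(t)) dt` is differentiable at
`ε = 0` with
`W′(0) = ∫₀¹ [∫ₜ¹ −2(s − G⁻¹(F(s)))·f(s)/g(G⁻¹(F(s))) ds + |t − G⁻¹(F(t))|²] φ(t) dt`. -/
theorem first_variation_w2_1d
    (f g F G Ginv φ Φ : ℝ → ℝ)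
    (hfc : ContinuousOn f (Icc 0 1)) (hgc : ContinuousOn g (Icc 0 1))
    (hfpos : ∀ x ∈ Icc (0:ℝ) 1, 0 < f x) (hgpos : ∀ x ∈ Icc (0:ℝ) 1, 0 < g x)
    (hf1 : (∫ x in (0:ℝ)..1, f x) = 1) (hg1 : (∫ x in (0:ℝ)..1, g x) = 1)
    (hF : ∀ x, F x = ∫ t in (0:ℝ)..x, f t) (hG : ∀ y, G y = ∫ t in (0:ℝ)..y, g t)
    (hGinv : ∀ y ∈ Icc (0:ℝ) 1, Ginv y ∈ Icc (0:ℝ) 1 ∧ G (Ginv y) = y)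
    (hφc : ContinuousOn φ (Icc 0 1)) (hφ0 : (∫ t in (0:ℝ)..1, φ t) = 0)
    (hΦ : ∀ t, Φ t = ∫ τ in (0:ℝ)..t, φ τ) :
    ∃ ε₀ > (0:ℝ),
      (∀ ε : ℝ, |ε| < ε₀ →
        (∀ t ∈ Icc (0:ℝ) 1, 0 ≤ f t + ε * φ t) ∧
        (∀ t ∈ Icc (0:ℝ) 1, F t + ε * Φ t ∈ Icc (0:ℝ) 1)) ∧
      HasDerivAt
        (fun ε : ℝ =>
          ∫ t in (0:ℝ)..1, |t - Ginv (F t + ε * Φ t)| ^ 2 * (f t + ε * φ t))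
        (∫ t in (0:ℝ)..1,
          ((∫ s in t..(1:ℝ), -2 * (s - Ginv (F s)) * (f s / g (Ginv (F s)))) +
            |t - Ginv (F t)| ^ 2) * φ t)
        0 := by
  obtain ⟨ε₀, hε₀, hmem⟩ := exists_perturbed_density_mem hfc hfpos hf1 hφc hφ0
  simp_rw [← hF, ← hΦ] at hmem
  refine ⟨ε₀, hε₀, hmem, ?_⟩
  have hext {u : ℝ → ℝ} (hu : ContinuousOn u (Icc 0 1)) :
      ∃ v : ℝ → ℝ, Continuous v ∧ (∀ t ∈ Icc (0:ℝ) 1, v t = u t) ∧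
        (∀ t, ∃ s ∈ Icc (0:ℝ) 1, v t = u s) ∧
        ∀ t ∈ Icc (0:ℝ) 1, ∫ s in (0:ℝ)..t, v s = ∫ s in (0:ℝ)..t, u s := by
    have heq : ∀ t ∈ Icc (0:ℝ) 1, IccExtend zero_le_one ((Icc (0:ℝ) 1).domRestrict u) t = u t :=
      fun t ht => IccExtend_of_mem _ _ ht
    refine ⟨_, hu.domRestrict.Icc_extend', heq, fun t => ⟨_, (projIcc 0 1 zero_le_one t).2, rfl⟩,
      fun t ht => intervalIntegral.integral_congr fun s hs => heq s ?_⟩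
    rw [uIcc_of_le ht.1] at hs
    exact ⟨hs.1, hs.2.trans ht.2⟩
  obtain ⟨f', hf'c, hf'eq, -, hf'int⟩ := hext hfc
  obtain ⟨φ', hφ'c, hφ'eq, -, hφ'int⟩ := hext hφc
  obtain ⟨g', hg'c, hg'eq, hg'val, hg'int⟩ := hext hgc
  obtain ⟨x₀, hx₀, hmin⟩ := isCompact_Icc.exists_isMinOn (nonempty_Icc.2 zero_le_one) hgc
  have hg'lower (x : ℝ) : g x₀ ≤ g' x := by
    obtain ⟨s, hs, hval⟩ := hg'val x
    exact hval ▸ hmin hs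
  obtain ⟨H, hHleft, hH⟩ :=
    exists_hasDerivAt_inverse_of_primitive hg'c (hgpos x₀ hx₀) hg'lower
  have hHc : Continuous H := continuous_iff_continuousAt.2 fun y => (hH y).continuousAt
  have hHeq : ∀ y ∈ Icc (0:ℝ) 1, H y = Ginv y := fun y hy => by
    obtain ⟨hmemy, hy'⟩ := hGinv y hy
    rw [hG, ← hg'int _ hmemy] at hy'
    conv_lhs => rw [← hy']
    exact hHleft _
  have hF'c : Continuous (fun t => ∫ s in (0:ℝ)..t, f' s) :=
    intervalIntegral.continuous_primitive (fun _ _ => hf'c.intervalIntegrable _ _) 0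
  have hH'c : Continuous (fun y => (g' (H y))⁻¹) :=
    (hg'c.comp hHc).inv₀ fun y => ((hgpos x₀ hx₀).trans_le (hg'lower _)).ne'
  have hFmem : ∀ t ∈ Icc (0:ℝ) 1, F t ∈ Icc (0:ℝ) 1 := fun t ht => by
    simpa using (hmem 0 (by simpa using hε₀)).2 t ht
  have hmain := hasDerivAt_transport_cost hf'c hφ'c hH hH'c hF'c
  refine (hmain.congr_of_eventuallyEq ?_).congr_deriv ?_
  · filter_upwards [Metric.ball_mem_nhds (0:ℝ) hε₀] with ε hε
    refine intervalIntegral.integral_congr fun t ht => ?_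
    rw [uIcc_of_le zero_le_one] at ht
    have hy := (hmem ε (by simpa using hε)).2 t ht
    simp only [sq_abs, hf'int t ht, hφ'int t ht, ← hF, ← hΦ, hHeq _ hy, hf'eq t ht, hφ'eq t ht]
  · refine intervalIntegral.integral_congr fun t ht => ?_
    rw [uIcc_of_le zero_le_one] at ht
    have hinner : ∫ s in t..(1:ℝ), -2 * (s - H (∫ r in (0:ℝ)..s, f' r)) *
          (f' s * (g' (H (∫ r in (0:ℝ)..s, f' r)))⁻¹) =
        ∫ s in t..(1:ℝ), -2 * (s - Ginv (F s)) * (f s / g (Ginv (F s))) := by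
      refine intervalIntegral.integral_congr fun s hs => ?_
      rw [uIcc_of_le ht.2] at hs
      have hs' : s ∈ Icc (0:ℝ) 1 := ⟨ht.1.trans hs.1, hs.2⟩
      simp only [hf'int s hs', ← hF, hHeq _ (hFmem s hs'), hf'eq s hs',
        hg'eq _ (hGinv _ (hFmem s hs')).1, div_eq_mul_inv]
    simp only [hinner, sq_abs, hf'int t ht, ← hF, hHeq _ (hFmem t ht), hφ'eq t ht]
end
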